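/- There is no free ℤ-module L of finite rank with a symmetric ℤ-valued bilinear form B that is even (B(x,x) ∈ 2ℤ for all x ∈ L), containing submodules S and T with all of the following properties: S and T are primitive (L/S and L/T torsion-free) and mutually orthogonal (B(s,t) = 0 for all s ∈ S, t ∈ T); S is free with basis C, D satisfying B(C,C) = 12, B(D,D) = −12, B(C,D) = 0; T is free with basis t₁, t₂ satisfying B(t₁,t₁) = B(t₂,t₂) = 10, B(t₁,t₂) = 0; and the quotient L/(S + T) has cardinality 4 with every element x satisfying 2x = 0 (i.e. L/(S+T) ≅ (ℤ/2)⊕²). -/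

import Mathlib

/-- Lemma 3.6: there is no even lattice `L` containing primitive mutually
orthogonal sublattices `S` (with basis `C, D` of Gram matrix `diag(12, -12)`)
and `T` (with basis `t₁, t₂` of Gram matrix `diag(10, 10)`) such that
`L/(S + T) ≅ (ℤ/2)⊕²` (of order 4). -/
theorem stmt_14 (L : Type) [AddCommGroup L] [Module ℤ L]
    [Module.Free ℤ L] [Module.Finite ℤ L]
    (B : LinearMap.BilinForm ℤ L)
    (hsymm : ∀ x y, B x y = B y x)
    (heven : ∀ x : L, 2 ∣ B x x)
    (S T : Submodule ℤ L)
    (hSprim : ∀ (x : L) (n : ℤ), n ≠ 0 → n • x ∈ S → x ∈ S)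
    (hTprim : ∀ (x : L) (n : ℤ), n ≠ 0 → n • x ∈ T → x ∈ T)
    (horth : ∀ s ∈ S, ∀ t ∈ T, B s t = 0)
    (C D : L) (hC : C ∈ S) (hD : D ∈ S)
    (hSspan : S = Submodule.span ℤ ({C, D} : Set L))
    (hSind : LinearIndependent ℤ ![C, D])
    (hBCC : B C C = 12) (hBDD : B D D = -12) (hBCD : B C D = 0)
    (t₁ t₂ : L) (ht₁ : t₁ ∈ T) (ht₂ : t₂ ∈ T)
    (hTspan : T = Submodule.span ℤ ({t₁, t₂} : Set L))
    (hTind : LinearIndependent ℤ ![t₁, t₂])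
    (hB11 : B t₁ t₁ = 10) (hB22 : B t₂ t₂ = 10) (hB12 : B t₁ t₂ = 0)
    (hcard : Nat.card (L ⧸ (S ⊔ T)) = 4)
    (h2elem : ∀ x : L ⧸ (S ⊔ T), x + x = 0) :
    False := by
  -- Replace the given `ℤ`-module structure by the canonical one, to which it is equal.
  obtain rfl := Subsingleton.elim (AddCommGroup.toIntModule L) ‹Module ℤ L›
  have mem_iff (x : L) : x ∈ S ⊔ T ↔ ∃ s ∈ S, ∃ c d : ℤ, s + (c • t₁ + d • t₂) = x := by
    simp only [hTspan, Submodule.mem_sup, Submodule.mem_span_pair, exists_exists_exists_and_eq]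
  have two_zsmul_mem (x : L) : (2 : ℤ) • x ∈ S ⊔ T := by
    have h := h2elem (Submodule.Quotient.mk x)
    rwa [← Submodule.Quotient.mk_add, Submodule.Quotient.mk_eq_zero, ← two_zsmul] at h
  -- Integrality of `B x x` forces the two `T`-coordinates of `2 • x` to have the same parity.
  have parity (x s : L) (hs : s ∈ S) (c d : ℤ)
      (h : s + (c • t₁ + d • t₂) = (2 : ℤ) • x) : Even c ↔ Even d := by
    obtain ⟨a, b, rfl⟩ := Submodule.mem_span_pair.1 (hSspan ▸ hs)
    have hn := congrArg (fun z => B z z) h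
    simp only [map_add, map_smul, LinearMap.add_apply, LinearMap.smul_apply, smul_eq_mul,
      hsymm D C, hsymm t₂ t₁, hsymm t₁ C, hsymm t₁ D, hsymm t₂ C, hsymm t₂ D, hBCC, hBDD, hBCD,
      hB11, hB22, hB12, horth C hC t₁ ht₁, horth C hC t₂ ht₂, horth D hD t₁ ht₁,
      horth D hD t₂ ht₂] at hn
    have hE : Even (c * c + d * d) := by
      rw [Int.even_iff]
      ring_nf at hn ⊢
      omega
    simpa [Int.even_add, Int.even_mul] using hE
  have mem_of_even (x s : L) (hs : s ∈ S) (c d : ℤ)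
      (h : s + (c • t₁ + d • t₂) = (2 : ℤ) • x) (hc : Even c) : x ∈ S ⊔ T := by
    obtain ⟨d', rfl⟩ := (parity x s hs c d h).1 hc
    obtain ⟨c', rfl⟩ := hc
    refine (mem_iff x).2 ⟨x - (c' • t₁ + d' • t₂), hSprim _ 2 two_ne_zero ?_, c', d', by abel⟩
    have : (2 : ℤ) • (x - (c' • t₁ + d' • t₂)) = s := by
      rw [smul_sub, ← h]
      module
    rwa [this]
  have sub_mem_of_notMem (x y : L) (hx : x ∉ S ⊔ T) (hy : y ∉ S ⊔ T) : x - y ∈ S ⊔ T := by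
    obtain ⟨s, hs, c, d, h⟩ := (mem_iff _).1 (two_zsmul_mem x)
    obtain ⟨s', hs', c', d', h'⟩ := (mem_iff _).1 (two_zsmul_mem y)
    have hc : ¬ Even c := fun hc => hx (mem_of_even x s hs c d h hc)
    have hc' : ¬ Even c' := fun hc => hy (mem_of_even y s' hs' c' d' h' hc)
    refine mem_of_even (x - y) (s - s') (S.sub_mem hs hs') (c - c') (d - d') ?_
      (by simp [Int.even_sub, hc, hc'])
    rw [smul_sub, ← h, ← h']
    module
  have eq_of_ne_zero (p q : L ⧸ (S ⊔ T)) (hp : p ≠ 0) (hq : q ≠ 0) : p = q := by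
    induction p using Submodule.Quotient.induction_on with | _ x
    induction q using Submodule.Quotient.induction_on with | _ y
    rw [Ne, Submodule.Quotient.mk_eq_zero] at hp hq
    exact (Submodule.Quotient.eq _).2 (sub_mem_of_notMem x y hp hq)
  have : Finite (L ⧸ (S ⊔ T)) := Nat.finite_of_card_ne_zero (by omega)
  have := Fintype.ofFinite (L ⧸ (S ⊔ T))
  rw [Nat.card_eq_fintype_card] at hcard
  obtain ⟨p, q, r, hpq, hpr, hqr⟩ :=
    Fintype.two_lt_card_iff.1 (show 2 < Fintype.card (L ⧸ (S ⊔ T)) by omega)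
  exact hpq (sub_left_injective
    (eq_of_ne_zero (p - r) (q - r) (sub_ne_zero.2 hpr) (sub_ne_zero.2 hqr)))
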